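/- General outer bound (31): For the deterministic two-hop interference channel with any parameters (n, m, f, n̄, m̄), the sum capacity satisfies C_sum ≤ n + f + (n̄ − f)⁺. -/

import Mathlib

open scoped Classical

namespace TwoHopIC

/-- The `q × q` lower-shift matrix `S^k` over `F₂`, with `(S^k)_{i,j} = 1` iff `i = j + k`. -/
def shiftMat (q k : ℕ) : Matrix (Fin q) (Fin q) (ZMod 2) :=
  Matrix.of fun i j => if (i : ℕ) = (j : ℕ) + k then 1 else 0

/-- Forward (first-hop) signal alphabet: vectors in `F₂^q` with `q = max m n`. -/
abbrev FSig (n m : ℕ) := Fin (max m n) → ZMod 2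

/-- Backward/second-hop signal alphabet: vectors in `F₂^q̄` with `q̄ = max(m̄, n̄, f)`. -/
abbrev BSig (f nb mb : ℕ) := Fin (max mb (max nb f)) → ZMod 2

/-- A blocklength-`N` code with message sets of sizes `M1`, `M2`:
causal encoders at the sources (using the messages and the overheard signals),
causal encoders at the relays (using their received signals), and decoders at the
destinations (using the `N` received signals). -/
structure Code (n m f nb mb N M1 M2 : ℕ) where
  encS1 : (t : ℕ) → Fin M1 → (Fin t → BSig f nb mb) → FSig n m
  encS2 : (t : ℕ) → Fin M2 → (Fin t → BSig f nb mb) → FSig n m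
  encR1 : (t : ℕ) → (Fin t → FSig n m) → BSig f nb mb
  encR2 : (t : ℕ) → (Fin t → FSig n m) → BSig f nb mb
  dec1 : (Fin N → BSig f nb mb) → Fin M1
  dec2 : (Fin N → BSig f nb mb) → Fin M2

variable {n m f nb mb N M1 M2 : ℕ}

/-- Given a history `h` of source signals `(X_{S1}[·], X_{S2}[·])`, the signal received by
relay 1 at time `s`: `Y_{R1}[s] = S^{q-n} X_{S1}[s] ⊕ S^{q-m} X_{S2}[s]`. -/
def relayRx1 (n m : ℕ) {t : ℕ} (h : Fin t → FSig n m × FSig n m) (s : Fin t) : FSig n m :=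
  (shiftMat (max m n) (max m n - n)).mulVec (h s).1 +
  (shiftMat (max m n) (max m n - m)).mulVec (h s).2

/-- `Y_{R2}[s] = S^{q-m} X_{S1}[s] ⊕ S^{q-n} X_{S2}[s]`. -/
def relayRx2 (n m : ℕ) {t : ℕ} (h : Fin t → FSig n m × FSig n m) (s : Fin t) : FSig n m :=
  (shiftMat (max m n) (max m n - m)).mulVec (h s).1 +
  (shiftMat (max m n) (max m n - n)).mulVec (h s).2

/-- Relay 1 transmitted signal `X_{R1}[s]`, a causal function of `Y_{R1}[1..s-1]`. -/
def relayTx1 (C : Code n m f nb mb N M1 M2) {t : ℕ}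
    (h : Fin t → FSig n m × FSig n m) (s : Fin t) : BSig f nb mb :=
  C.encR1 s.val (fun u => relayRx1 n m h ⟨u.val, lt_trans u.isLt s.isLt⟩)

/-- Relay 2 transmitted signal `X_{R2}[s]`, a causal function of `Y_{R2}[1..s-1]`. -/
def relayTx2 (C : Code n m f nb mb N M1 M2) {t : ℕ}
    (h : Fin t → FSig n m × FSig n m) (s : Fin t) : BSig f nb mb :=
  C.encR2 s.val (fun u => relayRx2 n m h ⟨u.val, lt_trans u.isLt s.isLt⟩)

/-- Source 1 overheard signal `Y_{S1}[s] = S^{q̄-n̄} X_{R1}[s] ⊕ S^{q̄-m̄} X_{R2}[s]`. -/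
def srcRx1 (C : Code n m f nb mb N M1 M2) {t : ℕ}
    (h : Fin t → FSig n m × FSig n m) (s : Fin t) : BSig f nb mb :=
  (shiftMat (max mb (max nb f)) (max mb (max nb f) - nb)).mulVec (relayTx1 C h s) +
  (shiftMat (max mb (max nb f)) (max mb (max nb f) - mb)).mulVec (relayTx2 C h s)

/-- Source 2 overheard signal `Y_{S2}[s] = S^{q̄-n̄} X_{R2}[s] ⊕ S^{q̄-m̄} X_{R1}[s]`. -/
def srcRx2 (C : Code n m f nb mb N M1 M2) {t : ℕ}
    (h : Fin t → FSig n m × FSig n m) (s : Fin t) : BSig f nb mb :=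
  (shiftMat (max mb (max nb f)) (max mb (max nb f) - nb)).mulVec (relayTx2 C h s) +
  (shiftMat (max mb (max nb f)) (max mb (max nb f) - mb)).mulVec (relayTx1 C h s)

/-- The history `(X_{S1}[1..t], X_{S2}[1..t])` of source signals determined by the
messages `(w1, w2)`: at each time the sources apply their causal encoders to their
message and the overheard signals so far. -/
def srcHist (C : Code n m f nb mb N M1 M2) (w1 : Fin M1) (w2 : Fin M2) :
    (t : ℕ) → Fin t → FSig n m × FSig n m
  | 0 => fun i => i.elim0
  | t + 1 =>
    Fin.snoc (srcHist C w1 w2 t)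
      (C.encS1 t w1 (srcRx1 C (srcHist C w1 w2 t)),
       C.encS2 t w2 (srcRx2 C (srcHist C w1 w2 t)))

/-- `(X_{S1}[t], X_{S2}[t])`. -/
def srcXat (C : Code n m f nb mb N M1 M2) (w1 : Fin M1) (w2 : Fin M2) (t : ℕ) :
    FSig n m × FSig n m :=
  srcHist C w1 w2 (t + 1) (Fin.last t)

/-- `Y_{R1}[t]`. -/
def relayRxAt1 (C : Code n m f nb mb N M1 M2) (w1 : Fin M1) (w2 : Fin M2) (t : ℕ) :
    FSig n m :=
  relayRx1 n m (srcHist C w1 w2 (t + 1)) (Fin.last t)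

/-- `Y_{R2}[t]`. -/
def relayRxAt2 (C : Code n m f nb mb N M1 M2) (w1 : Fin M1) (w2 : Fin M2) (t : ℕ) :
    FSig n m :=
  relayRx2 n m (srcHist C w1 w2 (t + 1)) (Fin.last t)

/-- `X_{R1}[t]`. -/
def relayTxAt1 (C : Code n m f nb mb N M1 M2) (w1 : Fin M1) (w2 : Fin M2) (t : ℕ) :
    BSig f nb mb :=
  relayTx1 C (srcHist C w1 w2 (t + 1)) (Fin.last t)

/-- `X_{R2}[t]`. -/
def relayTxAt2 (C : Code n m f nb mb N M1 M2) (w1 : Fin M1) (w2 : Fin M2) (t : ℕ) :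
    BSig f nb mb :=
  relayTx2 C (srcHist C w1 w2 (t + 1)) (Fin.last t)

/-- `Y_{D1}[t] = S^{q̄-f} X_{R1}[t]`. -/
def destRx1 (C : Code n m f nb mb N M1 M2) (w1 : Fin M1) (w2 : Fin M2) (t : ℕ) :
    BSig f nb mb :=
  (shiftMat (max mb (max nb f)) (max mb (max nb f) - f)).mulVec (relayTxAt1 C w1 w2 t)

/-- `Y_{D2}[t] = S^{q̄-f} X_{R2}[t]`. -/
def destRx2 (C : Code n m f nb mb N M1 M2) (w1 : Fin M1) (w2 : Fin M2) (t : ℕ) :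
    BSig f nb mb :=
  (shiftMat (max mb (max nb f)) (max mb (max nb f) - f)).mulVec (relayTxAt2 C w1 w2 t)

/-- Probability of decoding error under independent uniform messages: since the channel is
deterministic, this is the fraction of message pairs `(w1, w2)` on which some decoder errs. -/
noncomputable def errProb (C : Code n m f nb mb N M1 M2) : ℝ :=
  ((Finset.univ.filter fun w : Fin M1 × Fin M2 =>
      C.dec1 (fun t => destRx1 C w.1 w.2 t.val) ≠ w.1 ∨
      C.dec2 (fun t => destRx2 C w.1 w.2 t.val) ≠ w.2).card : ℝ) / ((M1 : ℝ) * (M2 : ℝ))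

/-- A nonnegative rate pair `(R1, R2)` is achievable if for every `ε > 0` there is a
blocklength `N ≥ 1` and a code with message sets of sizes `⌈2^(N R1)⌉`, `⌈2^(N R2)⌉`
whose probability of error is at most `ε`. -/
def Achievable (n m f nb mb : ℕ) (R1 R2 : ℝ) : Prop :=
  0 ≤ R1 ∧ 0 ≤ R2 ∧
    ∀ ε : ℝ, 0 < ε →
      ∃ N : ℕ, 0 < N ∧
        ∃ C : Code n m f nb mb N ⌈(2 : ℝ) ^ ((N : ℝ) * R1)⌉₊ ⌈(2 : ℝ) ^ ((N : ℝ) * R2)⌉₊,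
          errProb C ≤ ε

/-- The sum capacity `C_sum = sup { R1 + R2 : (R1, R2) achievable }`. -/
noncomputable def sumCapacity (n m f nb mb : ℕ) : ℝ :=
  sSup {r : ℝ | ∃ R1 R2 : ℝ, Achievable n m f nb mb R1 R2 ∧ r = R1 + R2}

/-- The shift `S^{q-k}` only keeps the top `k` entries of a vector. -/
lemma shiftMat_mulVec_congr {q k : ℕ} {x y : Fin q → ZMod 2}
    (h : ∀ i : Fin q, (i : ℕ) < k → x i = y i) :
    (shiftMat q (q - k)).mulVec x = (shiftMat q (q - k)).mulVec y := by
  funext i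
  simp only [Matrix.mulVec, dotProduct]
  refine Finset.sum_congr rfl fun j _ => ?_
  simp only [shiftMat, Matrix.of_apply]
  split_ifs with hij
  · rw [h j (by have := i.isLt; omega)]
  · simp

lemma srcHist_apply (C : Code n m f nb mb N M1 M2) (w1 : Fin M1) (w2 : Fin M2) :
    ∀ {t : ℕ} (s : Fin t), srcHist C w1 w2 t s = srcXat C w1 w2 s := by
  intro t
  induction t with
  | zero => exact fun s => s.elim0
  | succ t ih =>
    intro s
    refine Fin.lastCases rfl (fun s => ?_) s
    rw [srcHist, Fin.snoc_castSucc, ih]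
    rfl

lemma relayRxAt2_eq (C : Code n m f nb mb N M1 M2) (w1 : Fin M1) (w2 : Fin M2) (t : ℕ) :
    relayRxAt2 C w1 w2 t =
      (shiftMat (max m n) (max m n - m)).mulVec (srcXat C w1 w2 t).1 +
      (shiftMat (max m n) (max m n - n)).mulVec (srcXat C w1 w2 t).2 := rfl

lemma relayTx1_srcHist (C : Code n m f nb mb N M1 M2) (w1 : Fin M1) (w2 : Fin M2)
    {t : ℕ} (s : Fin t) :
    relayTx1 C (srcHist C w1 w2 t) s = relayTxAt1 C w1 w2 s := by
  simp only [relayTxAt1, relayTx1, relayRx1, srcHist_apply, Fin.val_last]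

lemma relayTx2_srcHist (C : Code n m f nb mb N M1 M2) (w1 : Fin M1) (w2 : Fin M2)
    {t : ℕ} (s : Fin t) :
    relayTx2 C (srcHist C w1 w2 t) s = relayTxAt2 C w1 w2 s := by
  simp only [relayTxAt2, relayTx2, relayRx2, srcHist_apply, Fin.val_last]

lemma relayTxAt2_eq (C : Code n m f nb mb N M1 M2) (w1 : Fin M1) (w2 : Fin M2) (t : ℕ) :
    relayTxAt2 C w1 w2 t = C.encR2 t fun u => relayRxAt2 C w1 w2 u := by
  simp only [relayTxAt2, relayTx2, relayRxAt2, relayRx2, srcHist_apply, Fin.val_last]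

lemma srcXat_fst (C : Code n m f nb mb N M1 M2) (w1 : Fin M1) (w2 : Fin M2) (t : ℕ) :
    (srcXat C w1 w2 t).1 = C.encS1 t w1 fun s =>
      (shiftMat (max mb (max nb f)) (max mb (max nb f) - nb)).mulVec (relayTxAt1 C w1 w2 s) +
      (shiftMat (max mb (max nb f)) (max mb (max nb f) - mb)).mulVec
        (relayTxAt2 C w1 w2 s) := by
  rw [srcXat, srcHist, Fin.snoc_last]
  refine congrArg (C.encS1 t w1) (funext fun s => ?_)
  rw [srcRx1, relayTx1_srcHist, relayTx2_srcHist]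

/-- The top `max n̄ f` bits sent by relay 1 and the top `n` bits sent by source 2 during the
`N` channel uses. -/
def genie (C : Code n m f nb mb N M1 M2) (w : Fin M1 × Fin M2) :
    (Fin N → Fin (max nb f) → ZMod 2) × (Fin N → Fin n → ZMod 2) :=
  (fun t i => relayTxAt1 C w.1 w.2 t (Fin.castLE (le_max_right _ _) i),
   fun t i => (srcXat C w.1 w.2 t).2 (Fin.castLE (le_max_right _ _) i))

lemma relayTxAt1_eq_of_genie_eq {C : Code n m f nb mb N M1 M2} {w v : Fin M1 × Fin M2}
    (h : genie C w = genie C v) {t : ℕ} (ht : t < N) (i : Fin (max mb (max nb f)))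
    (hi : (i : ℕ) < max nb f) :
    relayTxAt1 C w.1 w.2 t i = relayTxAt1 C v.1 v.2 t i :=
  congrFun (congrFun (congrArg Prod.fst h) ⟨t, ht⟩) ⟨i, hi⟩

lemma srcXat_snd_eq_of_genie_eq {C : Code n m f nb mb N M1 M2} {w v : Fin M1 × Fin M2}
    (h : genie C w = genie C v) {t : ℕ} (ht : t < N) (i : Fin (max m n)) (hi : (i : ℕ) < n) :
    (srcXat C w.1 w.2 t).2 i = (srcXat C v.1 v.2 t).2 i :=
  congrFun (congrFun (congrArg Prod.snd h) ⟨t, ht⟩) ⟨i, hi⟩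

lemma destRx1_eq_of_genie_eq {C : Code n m f nb mb N M1 M2} {w v : Fin M1 × Fin M2}
    (h : genie C w = genie C v) {t : ℕ} (ht : t < N) :
    destRx1 C w.1 w.2 t = destRx1 C v.1 v.2 t :=
  shiftMat_mulVec_congr fun i hi =>
    relayTxAt1_eq_of_genie_eq h ht i (hi.trans_le (le_max_right _ _))

lemma relayRxAt2_eq_of_genie_eq {C : Code n m f nb mb N M1 M2} {w v : Fin M1 × Fin M2}
    (h : genie C w = genie C v) (hwv : w.1 = v.1) {t : ℕ} (ht : t < N) :
    relayRxAt2 C w.1 w.2 t = relayRxAt2 C v.1 v.2 t := by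
  induction t using Nat.strong_induction_on with
  | _ t ih =>
    have hTx2 : ∀ s < t, relayTxAt2 C w.1 w.2 s = relayTxAt2 C v.1 v.2 s := by
      intro s hs
      rw [relayTxAt2_eq, relayTxAt2_eq]
      congr 1
      funext u
      exact ih u (u.isLt.trans hs) ((u.isLt.trans hs).trans ht)
    have hX1 : (srcXat C w.1 w.2 t).1 = (srcXat C v.1 v.2 t).1 := by
      rw [srcXat_fst, srcXat_fst]
      refine congrArg₂ (C.encS1 t) hwv (funext fun s => ?_)
      rw [hTx2 s s.isLt, shiftMat_mulVec_congr fun i hi =>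
        relayTxAt1_eq_of_genie_eq h (s.isLt.trans ht) i (hi.trans_le (le_max_left _ _))]
    rw [relayRxAt2_eq, relayRxAt2_eq, hX1,
      shiftMat_mulVec_congr (srcXat_snd_eq_of_genie_eq h ht)]

lemma destRx2_eq_of_genie_eq {C : Code n m f nb mb N M1 M2} {w v : Fin M1 × Fin M2}
    (h : genie C w = genie C v) (hwv : w.1 = v.1) {t : ℕ} (ht : t < N) :
    destRx2 C w.1 w.2 t = destRx2 C v.1 v.2 t := by
  rw [destRx2, destRx2, relayTxAt2_eq, relayTxAt2_eq]
  congr 2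
  funext u
  exact relayRxAt2_eq_of_genie_eq h hwv (u.isLt.trans ht)

/-- The genie signals identify every correctly decoded message pair, so there are at most
`2 ^ (N (n + max n̄ f))` such pairs. -/
lemma card_correct_le (C : Code n m f nb mb N M1 M2) :
    (Finset.univ.filter fun w : Fin M1 × Fin M2 =>
      ¬ (C.dec1 (fun t => destRx1 C w.1 w.2 t.val) ≠ w.1 ∨
        C.dec2 (fun t => destRx2 C w.1 w.2 t.val) ≠ w.2)).card ≤
      2 ^ (N * (n + max nb f)) := by
  refine (Finset.card_le_card_of_injOn (genie C) (fun _ _ => Finset.mem_univ _) ?_).trans_eq ?_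
  · intro w hw v hv h
    simp only [Finset.coe_filter, Finset.mem_univ, true_and, Set.mem_ofPred_eq, not_or,
      not_not] at hw hv
    have h1 : w.1 = v.1 := by
      rw [← hw.1, ← hv.1]
      congr 1
      funext t
      exact destRx1_eq_of_genie_eq h t.isLt
    have h2 : w.2 = v.2 := by
      rw [← hw.2, ← hv.2]
      congr 1
      funext t
      exact destRx2_eq_of_genie_eq h h1 t.isLt
    exact Prod.ext h1 h2
  · simp only [Finset.card_univ, Fintype.card_prod, Fintype.card_fun, Fintype.card_fin,
      ZMod.card]
    rw [← pow_mul, ← pow_mul, ← pow_add]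
    congr 1
    ring

lemma one_sub_errProb_mul_le (C : Code n m f nb mb N M1 M2) (h1 : 0 < M1) (h2 : 0 < M2) :
    (1 - errProb C) * ((M1 : ℝ) * M2) ≤ 2 ^ (N * (n + max nb f)) := by
  have hcard := Finset.card_filter_add_card_filter_not (s := Finset.univ)
    (fun w : Fin M1 × Fin M2 =>
      C.dec1 (fun t => destRx1 C w.1 w.2 t.val) ≠ w.1 ∨
      C.dec2 (fun t => destRx2 C w.1 w.2 t.val) ≠ w.2)
  have hle := card_correct_le C
  rw [Finset.card_univ, Fintype.card_prod, Fintype.card_fin, Fintype.card_fin] at hcard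
  have hcard' : (_ : ℝ) = _ := congrArg (Nat.cast (R := ℝ)) hcard
  have hle' : (_ : ℝ) ≤ _ := Nat.cast_le (α := ℝ).mpr hle
  push_cast at hcard' hle'
  have hM : (M1 : ℝ) * M2 ≠ 0 := by positivity
  rw [errProb, sub_mul, div_mul_cancel₀ _ hM]
  linarith

lemma Achievable.add_le {R1 R2 : ℝ} (h : Achievable n m f nb mb R1 R2) :
    R1 + R2 ≤ ((n + max nb f : ℕ) : ℝ) := by
  obtain ⟨-, -, h⟩ := h
  by_contra! hlt
  set K : ℕ := n + max nb f
  set a : ℝ := (2 : ℝ) ^ (R1 + R2 - K)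
  have ha : 1 < a := Real.one_lt_rpow (by norm_num) (by linarith)
  obtain ⟨N, hN, C, hC⟩ := h ((1 - a⁻¹) / 2) (by linarith [inv_lt_one_of_one_lt₀ ha])
  have hpos (R : ℝ) : 0 < ⌈(2 : ℝ) ^ ((N : ℝ) * R)⌉₊ := Nat.ceil_pos.mpr (by positivity)
  have hle := one_sub_errProb_mul_le C (hpos R1) (hpos R2)
  have hM : (2 : ℝ) ^ (N * K) * a ≤
      (⌈(2 : ℝ) ^ ((N : ℝ) * R1)⌉₊ : ℝ) * ⌈(2 : ℝ) ^ ((N : ℝ) * R2)⌉₊ :=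
    calc (2 : ℝ) ^ (N * K) * a
        = (2 : ℝ) ^ ((N : ℝ) * K + (R1 + R2 - K)) := by
          rw [Real.rpow_add two_pos, ← Nat.cast_mul, Real.rpow_natCast]
      _ ≤ (2 : ℝ) ^ ((N : ℝ) * R1 + N * R2) := by
          refine Real.rpow_le_rpow_of_exponent_le one_le_two ?_
          have : (1 : ℝ) ≤ N := by exact_mod_cast hN
          nlinarith
      _ = (2 : ℝ) ^ ((N : ℝ) * R1) * (2 : ℝ) ^ ((N : ℝ) * R2) := Real.rpow_add two_pos _ _
      _ ≤ _ := mul_le_mul (Nat.le_ceil _) (Nat.le_ceil _) (by positivity) (by positivity)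
  have hinv : a⁻¹ * a = 1 := inv_mul_cancel₀ (by positivity)
  have hinv0 : 0 < a⁻¹ := by positivity
  have hchain : (1 + a⁻¹) / 2 * ((2 : ℝ) ^ (N * K) * a) ≤ 2 ^ (N * K) :=
    (mul_le_mul (by linarith) hM (by positivity) (by linarith [inv_lt_one_of_one_lt₀ ha])).trans hle
  have hP : (0 : ℝ) < 2 ^ (N * K) := by positivity
  have hcancel : (1 + a⁻¹) / 2 * a ≤ 1 := by
    refine le_of_mul_le_mul_right ?_ hP
    linarith
  linarith

end TwoHopIC

open TwoHopIC in
/-- General outer bound (31): `C_sum ≤ n + f + (n̄ − f)⁺`. -/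
theorem sumCapacity_le_n_add_f (n m f nb mb : ℕ) :
    sumCapacity n m f nb mb ≤ (n : ℝ) + f + max ((nb : ℝ) - f) 0 := by
  have hK : ((n + max nb f : ℕ) : ℝ) = (n : ℝ) + f + max ((nb : ℝ) - f) 0 := by
    push_cast
    rw [add_assoc, ← max_add_add_left (f : ℝ), add_sub_cancel, add_zero]
  rw [← hK]
  refine Real.sSup_le ?_ (Nat.cast_nonneg _)
  rintro r ⟨R1, R2, h, rfl⟩
  exact h.add_le
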